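/- The sequence consisting of u_1 = Σ_{i=1}^m x_i, u_2 = Σ_{i=1}^m y_i, and the elements s_l = Σ_{i=1}^m x_i y_i^(2^l) for l = 0, 1, …, h−2 is a regular sequence in F_2[x_1, y_1, …, x_m, y_m], where h = m if m is odd and h = m−1 if m is even. -/

import Mathlib

open MvPolynomial

section Core
variable {σ K ι : Type*} [CommRing K]

/-- low-weight polynomials -/
noncomputable def lowW (K : Type*) [CommRing K] (W : (σ →₀ ℕ) →+ ℕ) (d : ℕ) : Submodule K (MvPolynomial σ K) :=
  restrictSupport K {n | W n < d}

theorem mem_lowW (W : (σ →₀ ℕ) →+ ℕ) (d : ℕ) (p : MvPolynomial σ K) :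
    p ∈ lowW K W d ↔ ∀ n ∈ p.support, W n < d := by
  unfold lowW
  rw [mem_restrictSupport_iff]
  rfl

theorem lowW_mono (W : (σ →₀ ℕ) →+ ℕ) {d d' : ℕ} (h : d ≤ d') :
    lowW K W d ≤ lowW K W d' := by
  intro p hp
  rw [mem_lowW] at *
  intro n hn
  exact (hp n hn).trans_le h

theorem lowW_mul (W : (σ →₀ ℕ) →+ ℕ) {d d' : ℕ} {p q : MvPolynomial σ K}
    (hp : p ∈ lowW K W d) (hq : q ∈ lowW K W (d' + 1)) : p * q ∈ lowW K W (d + d') := by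
  classical
  rw [mem_lowW] at *
  intro n hn
  have := support_mul p q hn
  obtain ⟨a, ha, b, hb, rfl⟩ := Finset.mem_add.1 this
  have h1 := hp a ha
  have h2 := hq b hb
  rw [map_add]; omega

theorem monomial_mem_lowW (W : (σ →₀ ℕ) →+ ℕ) {d : ℕ} {e : σ →₀ ℕ} (c : K) (h : W e < d) :
    monomial e c ∈ lowW K W d := by
  rw [mem_lowW]
  intro n hn
  have := support_monomial_subset hn
  simp at this
  rw [this]; exact h

/-- `p` has leading monomial `e` with coefficient one. -/
def LeadW (W : (σ →₀ ℕ) →+ ℕ) (p : MvPolynomial σ K) (e : σ →₀ ℕ) : Prop :=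
  p - monomial e 1 ∈ lowW K W (W e)

theorem LeadW.mul {W : (σ →₀ ℕ) →+ ℕ} {p q : MvPolynomial σ K} {a b : σ →₀ ℕ}
    (hp : LeadW W p a) (hq : LeadW W q b) : LeadW W (p * q) (a + b) := by
  unfold LeadW at *
  have h : p * q - monomial (a + b) 1 =
      (p - monomial a 1) * (q - monomial b 1) + ((q - monomial b 1) * monomial a 1
        + (p - monomial a 1) * monomial b 1) := by
    have : (monomial (a + b) (1 : K)) = monomial a 1 * monomial b 1 := by
      rw [monomial_mul, one_mul]
    rw [this]; ring
  rw [h, map_add]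
  refine add_mem (lowW_mul W hp (lowW_mono W (Nat.le_succ _) hq)) (add_mem ?_ ?_)
  · rw [add_comm (W a)]
    exact lowW_mul W hq (monomial_mem_lowW W 1 (Nat.lt_succ_self _))
  · exact lowW_mul W hp (monomial_mem_lowW W 1 (Nat.lt_succ_self _))

theorem LeadW.monomial (W : (σ →₀ ℕ) →+ ℕ) (e : σ →₀ ℕ) :
    LeadW W (MvPolynomial.monomial e (1 : K)) e := by
  unfold LeadW; rw [sub_self]; exact zero_mem _

theorem LeadW.pow {W : (σ →₀ ℕ) →+ ℕ} {p : MvPolynomial σ K} {a : σ →₀ ℕ}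
    (hp : LeadW W p a) (n : ℕ) : LeadW W (p ^ n) (n • a) := by
  induction n with
  | zero => rw [pow_zero, zero_smul]; exact LeadW.monomial W 0
  | succ n ih => rw [pow_succ, succ_nsmul]; exact ih.mul hp

theorem LeadW.prod {W : (σ →₀ ℕ) →+ ℕ} {f : ι → MvPolynomial σ K} {e : ι → σ →₀ ℕ}
    (hp : ∀ i, LeadW W (f i) (e i)) (s : Finset ι) : LeadW W (∏ i ∈ s, f i) (∑ i ∈ s, e i) := by
  classical
  induction s using Finset.induction_on with
  | empty => simp only [Finset.prod_empty, Finset.sum_empty]; exact LeadW.monomial W 0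
  | insert a s ha ih =>
    rw [Finset.prod_insert ha, Finset.sum_insert ha]; exact (hp a).mul ih

/-- multiplicity of `e` in `m` -/
def multE (e : σ →₀ ℕ) (he : e.support.Nonempty) (m : σ →₀ ℕ) : ℕ :=
  e.support.inf' he (fun i => m i / e i)

theorem multE_add_self (e : σ →₀ ℕ) (he : e.support.Nonempty) (m : σ →₀ ℕ) :
    multE e he (m + e) = multE e he m + 1 := by
  unfold multE
  have h : ∀ i ∈ e.support, (m + e) i / e i = m i / e i + 1 := by
    intro i hi
    rw [Finsupp.add_apply, Nat.add_div_right]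
    exact Nat.pos_of_ne_zero (Finsupp.mem_support_iff.1 hi)
  apply le_antisymm
  · obtain ⟨i, hi, hi'⟩ := Finset.exists_mem_eq_inf' he (fun i => m i / e i)
    rw [hi', ← h i hi]
    exact Finset.inf'_le _ hi
  · apply Finset.le_inf'
    intro i hi
    rw [h i hi]
    exact Nat.succ_le_succ (Finset.inf'_le (fun i => m i / e i) hi)

theorem multE_add_disj (e e' : σ →₀ ℕ) (he : e.support.Nonempty) (m : σ →₀ ℕ)
    (hd : Disjoint e.support e'.support) :
    multE e he (m + e') = multE e he m := by
  unfold multE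
  apply Finset.inf'_congr he rfl
  intro i hi
  have := Finset.disjoint_left.1 hd hi
  rw [Finsupp.notMem_support_iff] at this
  rw [Finsupp.add_apply, this, add_zero]

theorem multE_le (e : σ →₀ ℕ) (he : e.support.Nonempty) (m : σ →₀ ℕ) (i : σ) :
    multE e he m * e i ≤ m i := by
  by_cases hi : i ∈ e.support
  · exact (Nat.mul_le_mul_right _ (Finset.inf'_le (fun i => m i / e i) hi)).trans
      (Nat.div_mul_le_self _ _)
  · rw [Finsupp.notMem_support_iff] at hi
    rw [hi]; simp

theorem sum_multE_le [Fintype ι] (e : ι → σ →₀ ℕ) (he : ∀ j, (e j).support.Nonempty)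
    (hd : ∀ i j, i ≠ j → Disjoint (e i).support (e j).support) (m : σ →₀ ℕ) :
    ∑ j, multE (e j) (he j) m • e j ≤ m := by
  intro i
  rw [Finsupp.finsetSum_apply]
  by_cases h : ∃ j, i ∈ (e j).support
  · obtain ⟨j, hj⟩ := h
    rw [Finset.sum_eq_single j]
    · exact multE_le _ _ _ _
    · intro b _ hb
      have := Finset.disjoint_left.1 (hd j b hb.symm) hj
      rw [Finsupp.notMem_support_iff] at this
      simp [this]
    · simp
  · push Not at h
    rw [Finset.sum_eq_zero]
    · exact Nat.zero_le _
    · intro j _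
      have := h j
      rw [Finsupp.notMem_support_iff] at this
      simp [this]

/-- Main criterion. -/
theorem core_regular [Fintype ι] (W : (σ →₀ ℕ) →+ ℕ) (f : ι → MvPolynomial σ K)
    (e : ι → σ →₀ ℕ) (he : ∀ j, (e j).support.Nonempty)
    (hd : ∀ i j, i ≠ j → Disjoint (e i).support (e j).support)
    (hf : ∀ j, LeadW W (f j) (e j)) (S : Set ι) (j : ι) (hj : j ∉ S) (p : MvPolynomial σ K)
    (hp : f j * p ∈ Ideal.span (f '' S)) : p ∈ Ideal.span (f '' S) := by
  classical
  let v : (σ →₀ ℕ) → MvPolynomial σ K := fun m =>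
    (∏ j, f j ^ multE (e j) (he j) m) * monomial (m - ∑ j, multE (e j) (he j) m • e j) 1
  have hv : ∀ m, LeadW W (v m) m := by
    intro m
    have h1 := (LeadW.prod (fun j => (hf j).pow (multE (e j) (he j) m)) Finset.univ).mul
      (LeadW.monomial W (m - ∑ j, multE (e j) (he j) m • e j))
    rwa [add_tsub_cancel_of_le (sum_multE_le e he hd m)] at h1
  have hve : ∀ m j, v (m + e j) = f j * v m := by
    intro m j
    have h1 : ∀ i, multE (e i) (he i) (m + e j) = multE (e i) (he i) m + if i = j then 1 else 0 := by
      intro i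
      split_ifs with h
      · subst h; exact multE_add_self _ _ _
      · rw [multE_add_disj _ _ _ _ (hd i j h), add_zero]
    simp only [v, h1, pow_add, add_smul, Finset.prod_mul_distrib, Finset.sum_add_distrib,
      pow_ite, ite_smul, pow_one, pow_zero, one_smul, zero_smul, Finset.prod_ite_eq',
      Finset.sum_ite_eq', Finset.mem_univ, if_true, add_tsub_add_eq_tsub_right]
    ring
  let N : MvPolynomial σ K →ₗ[K] MvPolynomial σ K := (basisMonomials σ K).constr K v
  have hN : ∀ m c, N (monomial m c) = c • v m := by
    intro m c
    have : (monomial m c : MvPolynomial σ K) = c • basisMonomials σ K m := by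
      simp [smul_monomial]
    rw [this, map_smul, Module.Basis.constr_basis]
  have hNe : ∀ j p, N (monomial (e j) 1 * p) = f j * N p := by
    intro j p
    induction p using MvPolynomial.induction_on' with
    | monomial m c =>
      rw [monomial_mul, hN, hN, add_comm, hve, one_mul, mul_smul_comm]
    | add p q hp hq => rw [mul_add, map_add, map_add, mul_add, hp, hq]
  have hcontr : ∀ d p, p ∈ lowW K W (d + 1) → p - N p ∈ lowW K W d := by
    intro d p hp
    have : p - N p = ∑ m ∈ p.support, (-coeff m p) • (v m - monomial m 1) := by
      conv_lhs => rw [p.as_sum]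
      rw [map_sum, ← Finset.sum_sub_distrib]
      refine Finset.sum_congr rfl fun m _ => ?_
      rw [hN, smul_sub, smul_monomial]
      simp [neg_smul]
      abel
    rw [this]
    refine Submodule.sum_mem _ fun m hm => Submodule.smul_mem _ _ ?_
    rw [mem_lowW] at hp
    exact lowW_mono W (Nat.lt_succ_iff.1 (hp m hm)) (hv m)
  have hlow : ∀ p : MvPolynomial σ K, ∃ d, p ∈ lowW K W d := by
    intro p
    refine ⟨p.support.sup W + 1, (mem_lowW _ _ _).2 fun n hn => ?_⟩
    exact Nat.lt_succ_of_le (Finset.le_sup hn)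
  have hzero : ∀ p, p ∈ lowW K W 0 → p = 0 := by
    intro p hp
    rw [mem_lowW] at hp
    rw [← support_eq_empty, Finset.eq_empty_iff_forall_notMem]
    intro n hn
    exact absurd (hp n hn) (Nat.not_lt_zero _)
  have hsurj : ∀ d p, p ∈ lowW K W d → ∃ q, N q = p := by
    intro d
    induction d with
    | zero => intro p hp; exact ⟨0, by rw [hzero p hp, map_zero]⟩
    | succ d ih =>
      intro p hp
      obtain ⟨q, hq⟩ := ih _ (hcontr d p hp)
      exact ⟨q + p, by rw [map_add, hq]; ring⟩
  have hinj : ∀ d p, p ∈ lowW K W d → N p = 0 → p = 0 := by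
    intro d
    induction d with
    | zero => intro p hp _; exact hzero p hp
    | succ d ih =>
      intro p hp h0
      have := hcontr d p hp
      rw [h0, sub_zero] at this
      exact ih p this h0
  -- transfer
  let g : ι → MvPolynomial σ K := fun j => monomial (e j) 1
  have hto : ∀ p, p ∈ Ideal.span (g '' S) → ∀ a, N (a * p) ∈ Ideal.span (f '' S) := by
    intro p hp
    induction hp using Submodule.span_induction with
    | mem x hx =>
      obtain ⟨i, hi, rfl⟩ := hx
      intro a
      rw [mul_comm, hNe i a]
      exact Ideal.mul_mem_right _ _ (Ideal.subset_span ⟨i, hi, rfl⟩)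
    | zero => intro a; rw [mul_zero, map_zero]; exact zero_mem _
    | add x y _ _ hx hy => intro a; rw [mul_add, map_add]; exact add_mem (hx a) (hy a)
    | smul b x _ h => intro a; rw [smul_eq_mul, ← mul_assoc]; exact h _
  have hback : ∀ p, p ∈ Ideal.span (f '' S) →
      ∀ a, ∃ q ∈ Ideal.span (g '' S), N q = a * p := by
    intro p hp
    induction hp using Submodule.span_induction with
    | mem x hx =>
      obtain ⟨i, hi, rfl⟩ := hx
      intro a
      obtain ⟨d, hd'⟩ := hlow a
      obtain ⟨q, rfl⟩ := hsurj d a hd'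
      refine ⟨g i * q, Ideal.mul_mem_right _ _ (Ideal.subset_span ⟨i, hi, rfl⟩), ?_⟩
      rw [hNe i q, mul_comm]
    | zero => intro a; exact ⟨0, zero_mem _, by rw [map_zero, mul_zero]⟩
    | add x y _ _ hx hy =>
      intro a
      obtain ⟨q, hq, h1⟩ := hx a
      obtain ⟨r, hr, h2⟩ := hy a
      exact ⟨q + r, add_mem hq hr, by rw [map_add, h1, h2, mul_add]⟩
    | smul b x _ h => intro a; rw [smul_eq_mul, ← mul_assoc]; exact h _
  obtain ⟨d, hd'⟩ := hlow p
  obtain ⟨p', rfl⟩ := hsurj d p hd'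
  obtain ⟨q, hq, hq'⟩ := hback _ hp 1
  rw [one_mul, ← hNe] at hq'
  have hqe : q = monomial (e j) 1 * p' := by
    obtain ⟨d, hd''⟩ := hlow (q - monomial (e j) 1 * p')
    exact sub_eq_zero.1 (hinj d _ hd'' (by rw [map_sub, hq', sub_self]))
  rw [hqe] at hq
  have hmon : p' ∈ Ideal.span (g '' S) := by
    have himg : g '' S = (fun s => monomial s (1 : K)) '' (e '' S) := by
      rw [Set.image_image]
    rw [himg, mem_ideal_span_monomial_image] at hq ⊢
    intro m hm
    have hm' : e j + m ∈ (monomial (e j) 1 * p').support := by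
      rw [mem_support_iff, coeff_monomial_mul, one_mul]
      exact mem_support_iff.1 hm
    obtain ⟨_, ⟨i, hi, rfl⟩, hle⟩ := hq _ hm'
    refine ⟨e i, ⟨i, hi, rfl⟩, fun x => ?_⟩
    by_cases hx : x ∈ (e i).support
    · have hij : i ≠ j := fun h => hj (h ▸ hi)
      have := Finset.disjoint_left.1 (hd i j hij) hx
      rw [Finsupp.notMem_support_iff] at this
      have h2 := hle x
      rwa [Finsupp.add_apply, this, zero_add] at h2
    · rw [Finsupp.notMem_support_iff] at hx
      rw [hx]; exact Nat.zero_le _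
  have := hto _ hmon 1
  rwa [one_mul] at this

theorem LeadW.sum {τ : Type*} [Fintype τ] (W : (σ →₀ ℕ) →+ ℕ) (a : τ → σ →₀ ℕ) (i₀ : τ)
    (h : ∀ i, i ≠ i₀ → W (a i) < W (a i₀)) :
    LeadW W (∑ i, MvPolynomial.monomial (a i) (1 : K)) (a i₀) := by
  classical
  unfold LeadW
  rw [← Finset.add_sum_erase _ _ (Finset.mem_univ i₀), add_sub_cancel_left]
  refine Submodule.sum_mem _ fun i hi => ?_
  exact monomial_mem_lowW W 1 (h i (Finset.ne_of_mem_erase hi))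

/-- Ideal-theoretic form of weak regularity. -/
def SeqReg {R : Type*} [CommRing R] {n : ℕ} (f : Fin n → R) : Prop :=
  ∀ j p, f j * p ∈ Ideal.span (f '' Set.Iio j) → p ∈ Ideal.span (f '' Set.Iio j)

theorem SeqReg.of_lead {n : ℕ} (w : σ → ℕ) (f : Fin n → MvPolynomial σ K)
    (e : Fin n → σ →₀ ℕ) (he : ∀ j, e j ≠ 0)
    (hd : ∀ i j, i ≠ j → ∀ x, e i x = 0 ∨ e j x = 0)
    (hf : ∀ j, LeadW (Finsupp.weight w) (f j) (e j)) : SeqReg f := by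
  intro j p hp
  refine core_regular (Finsupp.weight w) f e (fun j => ?_) (fun i j hij => ?_) hf _ j ?_ p hp
  · exact Finsupp.support_nonempty_iff.2 (he j)
  · rw [Finset.disjoint_left]
    intro x hx hx'
    rw [Finsupp.mem_support_iff] at hx hx'
    rcases hd i j hij x with h | h
    · exact hx h
    · exact hx' h
  · exact lt_irrefl j

theorem SeqReg.transfer {R : Type*} [CommRing R] {n : ℕ} (ψ : R ≃+* R) (f g : Fin n → R)
    (h : ∀ j, ψ (f j) - g j ∈ Ideal.span (g '' Set.Iio j)) (hg : SeqReg g) : SeqReg f := by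
  have h1 : ∀ j, Ideal.span ((fun i => ψ (f i)) '' Set.Iio j) ≤ Ideal.span (g '' Set.Iio j) := by
    intro j
    rw [Ideal.span_le]
    rintro _ ⟨i, hi, rfl⟩
    have := add_mem (Ideal.span_mono (Set.image_mono (Set.Iio_subset_Iio (le_of_lt hi))) (h i))
      (Ideal.subset_span (s := g '' Set.Iio j) ⟨i, hi, rfl⟩)
    rwa [sub_add_cancel] at this
  have h2 : ∀ i, g i ∈ Ideal.span ((fun i => ψ (f i)) '' Set.Iic i) := by
    intro i
    induction i using WellFoundedLT.induction with
    | ind i ih =>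
      have hle : Ideal.span (g '' Set.Iio i) ≤ Ideal.span ((fun i => ψ (f i)) '' Set.Iic i) := by
        rw [Ideal.span_le]
        rintro _ ⟨l, hl, rfl⟩
        exact Ideal.span_mono (Set.image_mono (Set.Iic_subset_Iic.2 (le_of_lt hl))) (ih l hl)
      have := sub_mem (Ideal.subset_span (s := (fun i => ψ (f i)) '' Set.Iic i)
        ⟨i, le_refl i, rfl⟩) (hle (h i))
      simpa using this
  have h3 : ∀ j, Ideal.span (g '' Set.Iio j) = Ideal.map ψ (Ideal.span (f '' Set.Iio j)) := by
    intro j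
    rw [Ideal.map_span, Set.image_image]
    refine le_antisymm ?_ (h1 j)
    rw [Ideal.span_le]
    rintro _ ⟨l, hl, rfl⟩
    exact Ideal.span_mono (Set.image_mono (Set.Iic_subset_Iio.2 hl)) (h2 l)
  have h4 : ∀ j x, ψ x ∈ Ideal.span (g '' Set.Iio j) ↔ x ∈ Ideal.span (f '' Set.Iio j) := by
    intro j x
    rw [h3]
    constructor
    · intro hx
      obtain ⟨y, hy, hxy⟩ := (Ideal.mem_map_iff_of_surjective ψ ψ.surjective).1 hx
      rwa [← ψ.injective hxy]
    · exact Ideal.mem_map_of_mem ψ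
  intro j p hp
  rw [← h4] at hp ⊢
  apply hg
  rw [map_mul] at hp
  have := sub_mem hp (Ideal.mul_mem_right (ψ p) _ (h j))
  convert this using 1
  ring

theorem SeqReg.isRegular {n : ℕ} [Nontrivial K] (f : Fin n → MvPolynomial σ K) (hf : SeqReg f)
    (h0 : ∀ j, constantCoeff (f j) = 0) :
    RingTheory.Sequence.IsRegular (MvPolynomial σ K) (List.ofFn f) := by
  constructor
  · constructor
    intro i hi
    rw [List.length_ofFn] at hi
    have h1 : (Ideal.ofList ((List.ofFn f).take i) • ⊤ : Ideal (MvPolynomial σ K)) =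
        Ideal.span (f '' Set.Iio ⟨i, hi⟩) := by
      rw [smul_eq_mul, Ideal.mul_top]
      refine congrArg Ideal.span ?_
      ext x
      change x ∈ List.take i (List.ofFn f) ↔ _
      simp only [List.mem_take_iff_getElem, Set.mem_image, Set.mem_Iio]
      constructor
      · rintro ⟨l, hl, rfl⟩
        rw [List.length_ofFn] at hl
        exact ⟨⟨l, by omega⟩, by rw [Fin.mk_lt_mk]; omega, by simp⟩
      · rintro ⟨l, hl, rfl⟩
        have : (l : ℕ) < i := hl
        exact ⟨l, by rw [List.length_ofFn]; omega, by simp⟩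
    rw [h1, isSMulRegular_iff_right_eq_zero_of_smul]
    intro x hx
    obtain ⟨p, rfl⟩ := Submodule.Quotient.mk_surjective _ x
    rw [← Submodule.Quotient.mk_smul, Submodule.Quotient.mk_eq_zero] at hx
    rw [Submodule.Quotient.mk_eq_zero]
    apply hf
    simpa using hx
  · rw [smul_eq_mul, Ideal.mul_top]
    intro h
    have h1 : Ideal.ofList (List.ofFn f) ≤ RingHom.ker (constantCoeff (σ := σ) (R := K)) := by
      rw [Ideal.ofList, Ideal.span_le]
      intro x hx
      obtain ⟨j, rfl⟩ := (List.mem_ofFn' f x).1 hx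
      exact h0 j
    rw [← h] at h1
    have := h1 (show (1 : MvPolynomial σ K) ∈ ⊤ from trivial)
    rw [RingHom.mem_ker, map_one] at this
    exact one_ne_zero this
end Core

section Main

theorem line_lt {a b C : ℕ} (h : a ≠ b) (ha : a * a ≤ C) (hb : b * b ≤ C) :
    (C - a * a) + b * (2 * a) < (C - b * b) + b * (2 * b) := by
  have : 2 * (a * b) < a * a + b * b := by
    rcases lt_or_gt_of_ne h with h | h <;> nlinarith
  zify [ha, hb] at *
  nlinarith

theorem monomial_xy {m : ℕ} (i : Fin m) (q : ℕ) :
    (X (Sum.inl i) * X (Sum.inr i) ^ q : MvPolynomial (Fin m ⊕ Fin m) (ZMod 2)) =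
      monomial (Finsupp.single (Sum.inl i) 1 + Finsupp.single (Sum.inr i) q) 1 := by
  rw [X_pow_eq_monomial, X, monomial_mul, one_mul]

/-- abscissae of the tangent lines, even case -/
def tEven : ℕ → ℕ
  | 0 => 0
  | i + 1 => 2 ^ i

theorem tEven_strictMono : StrictMono tEven := by
  apply strictMono_nat_of_lt_succ
  intro n
  cases n with
  | zero => simp [tEven]
  | succ n => simp only [tEven]; exact Nat.pow_lt_pow_right (by norm_num) (Nat.lt_succ_self _)

theorem even_reg (k : ℕ) : SeqReg (R := MvPolynomial (Fin (k + 2) ⊕ Fin (k + 2)) (ZMod 2))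
    (n := k + 2)
    (Fin.cons (∑ i, X (Sum.inl i)) (Fin.cons (∑ i, X (Sum.inr i))
      (fun l : Fin k => ∑ i, X (Sum.inl i) * X (Sum.inr i) ^ (2 ^ (l : ℕ))))) := by
  let C := tEven (k + 2) * tEven (k + 2)
  have hC : ∀ i : Fin (k + 2), tEven i * tEven i ≤ C := fun i =>
    Nat.mul_le_mul (tEven_strictMono.monotone i.2.le) (tEven_strictMono.monotone i.2.le)
  refine SeqReg.of_lead
    (Sum.elim (fun i : Fin (k + 2) => C - tEven i * tEven i)
      (fun i : Fin (k + 2) => 2 * tEven i)) _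
    (Fin.cons (Finsupp.single (Sum.inl 0) 1) (Fin.cons (Finsupp.single (Sum.inr (Fin.last _)) 1)
      (fun l : Fin k => Finsupp.single (Sum.inl l.succ.castSucc) 1 +
        Finsupp.single (Sum.inr l.succ.castSucc) (2 ^ (l : ℕ))))) ?_ ?_ ?_
  · intro j
    refine Fin.cases ?_ (fun j => Fin.cases ?_ (fun l => ?_) j) j
    · simp
    · simp
    · simp
  · intro i j
    refine Fin.cases ?_ (fun j => Fin.cases ?_ (fun l => ?_) j) j <;>
    refine Fin.cases ?_ (fun i => Fin.cases ?_ (fun l => ?_) i) i <;>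
    rintro hij (x | x) <;>
    simp [Finsupp.single_apply] at hij ⊢ <;> clear hC <;> grind [Fin.castSucc_inj]
  · intro j
    refine Fin.cases ?_ (fun j => Fin.cases ?_ (fun l => ?_) j) j
    · refine LeadW.sum _ (fun i => Finsupp.single (Sum.inl i) 1) 0 ?_
      intro i hi
      have h1 : 0 < tEven i := tEven_strictMono (show 0 < (i : ℕ) from Fin.pos_iff_ne_zero.2 hi)
      have h2 := hC i
      have h3 := Nat.mul_pos h1 h1
      have h4 : tEven ((0 : Fin (k + 2)) : ℕ) = 0 := rfl
      simp only [Finsupp.weight_single, one_smul, Sum.elim_inl, h4]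
      omega
    · refine LeadW.sum _ (fun i => Finsupp.single (Sum.inr i) 1) (Fin.last _) ?_
      intro i hi
      have h1 : tEven i < tEven (k + 1) := tEven_strictMono (Fin.lt_last_iff_ne_last.2 hi)
      simp [Finsupp.weight_single]
      omega
    · simp only [Fin.cons_succ, monomial_xy]
      refine LeadW.sum _ (fun i => Finsupp.single (Sum.inl i) 1 +
        Finsupp.single (Sum.inr i) (2 ^ (l : ℕ))) l.succ.castSucc ?_
      intro i hi
      have h1 : tEven i ≠ tEven (l + 1) := fun h => hi (Fin.ext (tEven_strictMono.injective h))
      have := line_lt h1 (hC i) (hC l.succ.castSucc)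
      simpa [Finsupp.weight_single, tEven] using this

theorem odd_reg' (k : ℕ) : SeqReg (R := MvPolynomial (Fin (k + 1) ⊕ Fin (k + 1)) (ZMod 2))
    (n := k + 2)
    (Fin.cons (∑ i, X (Sum.inl i)) (Fin.cons (∑ i, X (Sum.inr i))
      (fun l : Fin k => ∑ i : Fin k, X (Sum.inl i.castSucc) *
        X (Sum.inr i.castSucc) ^ (2 ^ (l : ℕ))))) := by
  let C := 2 ^ k * 2 ^ k
  have hC : ∀ i : Fin k, 2 ^ (i : ℕ) * 2 ^ (i : ℕ) ≤ C := fun i =>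
    Nat.mul_le_mul (Nat.pow_le_pow_right (by norm_num) i.2.le)
      (Nat.pow_le_pow_right (by norm_num) i.2.le)
  refine SeqReg.of_lead
    (Sum.elim (fun i : Fin (k + 1) => if (i : ℕ) = k then C else C - 2 ^ (i : ℕ) * 2 ^ (i : ℕ))
      (fun i : Fin (k + 1) => 2 * 2 ^ (i : ℕ))) _
    (Fin.cons (Finsupp.single (Sum.inl (Fin.last _)) 1)
      (Fin.cons (Finsupp.single (Sum.inr (Fin.last _)) 1)
      (fun l : Fin k => Finsupp.single (Sum.inl l.castSucc) 1 +
        Finsupp.single (Sum.inr l.castSucc) (2 ^ (l : ℕ))))) ?_ ?_ ?_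
  · intro j
    refine Fin.cases ?_ (fun j => Fin.cases ?_ (fun l => ?_) j) j
    · simp
    · simp
    · simp
  · intro i j
    refine Fin.cases ?_ (fun j => Fin.cases ?_ (fun l => ?_) j) j <;>
    refine Fin.cases ?_ (fun i => Fin.cases ?_ (fun l => ?_) i) i <;>
    rintro hij (x | x) <;>
    simp [Finsupp.single_apply] at hij ⊢ <;> clear hC <;> grind [Fin.castSucc_inj]
  · intro j
    refine Fin.cases ?_ (fun j => Fin.cases ?_ (fun l => ?_) j) j
    · refine LeadW.sum _ (fun i => Finsupp.single (Sum.inl i) 1) (Fin.last _) ?_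
      intro i hi
      have hi' : (i : ℕ) < k := Fin.lt_last_iff_ne_last.2 hi
      have h1 : 0 < 2 ^ (i : ℕ) * 2 ^ (i : ℕ) := by positivity
      have h2 := hC ⟨i, hi'⟩
      simp only at h2
      simp [Finsupp.weight_single, hi'.ne]
      omega
    · refine LeadW.sum _ (fun i => Finsupp.single (Sum.inr i) 1) (Fin.last _) ?_
      intro i hi
      have h1 : 2 ^ (i : ℕ) < 2 ^ k :=
        Nat.pow_lt_pow_right (by norm_num) (Fin.lt_last_iff_ne_last.2 hi)
      simp [Finsupp.weight_single]
      omega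
    · simp only [Fin.cons_succ, monomial_xy]
      refine LeadW.sum _ (fun i : Fin k => Finsupp.single (Sum.inl i.castSucc) 1 +
        Finsupp.single (Sum.inr i.castSucc) (2 ^ (l : ℕ))) l ?_
      intro i hi
      have h1 : 2 ^ (i : ℕ) ≠ 2 ^ (l : ℕ) := fun h =>
        hi (Fin.ext (Nat.pow_right_injective (le_refl 2) h))
      have := line_lt h1 (hC i) (hC l)
      simpa [Finsupp.weight_single, i.2.ne, l.2.ne] using this

/-- the substitution `y_i ↦ y_i + y_last` for `i ≠ last` -/
noncomputable def shiftHom (k : ℕ) : MvPolynomial (Fin (k + 1) ⊕ Fin (k + 1)) (ZMod 2) →ₐ[ZMod 2]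
    MvPolynomial (Fin (k + 1) ⊕ Fin (k + 1)) (ZMod 2) :=
  aeval (Sum.elim (fun i => X (Sum.inl i))
    (fun i => if i = Fin.last k then X (Sum.inr i) else X (Sum.inr i) + X (Sum.inr (Fin.last k))))

theorem shiftHom_comp (k : ℕ) : (shiftHom k).comp (shiftHom k) = AlgHom.id _ _ := by
  apply MvPolynomial.algHom_ext
  rintro (i | i)
  · simp [shiftHom]
  · by_cases h : i = Fin.last k
    · simp [shiftHom, h]
    · simp [shiftHom, h, add_assoc, CharTwo.add_self_eq_zero]

theorem odd_reg (k : ℕ) (hk : Even k) :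
    SeqReg (R := MvPolynomial (Fin (k + 1) ⊕ Fin (k + 1)) (ZMod 2)) (n := k + 2)
    (Fin.cons (∑ i, X (Sum.inl i)) (Fin.cons (∑ i, X (Sum.inr i))
      (fun l : Fin k => ∑ i, X (Sum.inl i) * X (Sum.inr i) ^ (2 ^ (l : ℕ))))) := by
  refine SeqReg.transfer
    (AlgEquiv.ofAlgHom (shiftHom k) (shiftHom k) (shiftHom_comp k) (shiftHom_comp k)).toRingEquiv
    _ _ ?_ (odd_reg' k)
  intro j
  refine Fin.cases ?_ (fun j => Fin.cases ?_ (fun l => ?_) j) j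
  · simp [shiftHom]
  · have hk' : (k : MvPolynomial (Fin (k + 1) ⊕ Fin (k + 1)) (ZMod 2)) = 0 := by
      rw [CharP.cast_eq_zero_iff _ 2]; exact hk.two_dvd
    simp [shiftHom, Fin.sum_univ_castSucc, Finset.sum_add_distrib, hk', Fin.castSucc_ne_last]
  · have key : (∑ i : Fin (k+1), shiftHom k (X (Sum.inl i)) *
        shiftHom k (X (Sum.inr i)) ^ (2 ^ (l : ℕ))) -
        ∑ i : Fin k, X (Sum.inl i.castSucc) * X (Sum.inr i.castSucc) ^ (2 ^ (l : ℕ)) =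
        X (Sum.inr (Fin.last k)) ^ (2 ^ (l : ℕ)) * ∑ i, X (Sum.inl i) := by
      simp [shiftHom, Fin.sum_univ_castSucc, Fin.castSucc_ne_last, add_pow_char_pow, mul_add,
        Finset.sum_add_distrib, Finset.mul_sum]
      simp only [mul_comm]
      ring
    have h2 := Ideal.mul_mem_left (Ideal.span ((Fin.cons (∑ i, X (Sum.inl i))
      (Fin.cons (∑ i, X (Sum.inr i)) (fun l : Fin k => ∑ i : Fin k, X (Sum.inl i.castSucc) *
        X (Sum.inr i.castSucc) ^ (2 ^ (l : ℕ)))) : Fin (k + 2) →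
          MvPolynomial (Fin (k + 1) ⊕ Fin (k + 1)) (ZMod 2)) '' Set.Iio l.succ.succ))
      (X (Sum.inr (Fin.last k)) ^ (2 ^ (l : ℕ)))
      (Ideal.subset_span ⟨0, Fin.succ_pos _, rfl⟩)
    rw [Fin.cons_zero, ← key] at h2
    simpa using h2

end Main

theorem even_case_sequence_regular (m : ℕ) (hm : 0 < m) :
    RingTheory.Sequence.IsRegular (MvPolynomial (Fin m ⊕ Fin m) (ZMod 2))
      ((∑ i : Fin m, (X (Sum.inl i) : MvPolynomial (Fin m ⊕ Fin m) (ZMod 2))) ::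
        (∑ i : Fin m, X (Sum.inr i)) ::
        List.ofFn (fun l : Fin ((if m % 2 = 1 then m else m - 1) - 1) =>
          ∑ i : Fin m, X (Sum.inl i) * X (Sum.inr i) ^ (2 ^ (l : ℕ)))) := by
  have main : ∀ k, (if m % 2 = 1 then m else m - 1) - 1 = k →
      SeqReg (R := MvPolynomial (Fin m ⊕ Fin m) (ZMod 2)) (n := k + 2)
      (Fin.cons (∑ i, X (Sum.inl i)) (Fin.cons (∑ i, X (Sum.inr i))
      (fun l : Fin k => ∑ i, X (Sum.inl i) * X (Sum.inr i) ^ (2 ^ (l : ℕ))))) := by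
    intro k hk
    by_cases h : m % 2 = 1
    · rw [if_pos h] at hk
      obtain rfl : m = k + 1 := by omega
      exact odd_reg k (Nat.even_iff.2 (by omega))
    · rw [if_neg h] at hk
      obtain rfl : m = k + 2 := by omega
      exact even_reg k
  have := (main _ rfl).isRegular _ (by
    intro j
    refine Fin.cases ?_ (fun j => Fin.cases ?_ (fun l => ?_) j) j <;> simp)
  rw [List.ofFn_succ, List.ofFn_succ] at this
  exact this
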